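/- arXiv:2402.07017 — 4 statements merged into one kernel-verified Lean document; each statement's English description precedes it below -/
import Mathlib

section
/- Let ν̂ : [0,∞) → [0,∞) satisfy the strong monotonicity and Lipschitz conditions with constants 0 < ν_ ≤ ν̄ < ∞, and let d ≥ 1. Then the vector field a ↦ ν̂(|a|)a on ℝ^d is strongly monotone with the same constant: for all a, b ∈ ℝ^d, ⟨ν̂(|a|)a − ν̂(|b|)b, a − b⟩ ≥ ν_ |a − b|². -/
open scoped RealInnerProductSpace

/-- If `s ↦ ν̂(s)s` is strongly monotone with constant `ν_ > 0` and Lipschitz with constant `ν̄`,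
then the vector field `a ↦ ν̂(|a|)a` on `ℝ^d` is strongly monotone with the same constant:
`⟨ν̂(|a|)a − ν̂(|b|)b, a − b⟩ ≥ ν_ |a − b|²` for all `a, b`. -/
theorem stmt_2 (d : ℕ) (hd : 1 ≤ d) (ν : ℝ → ℝ) (νlo νhi : ℝ)
    (hlo : 0 < νlo) (hle : νlo ≤ νhi)
    (hnn : ∀ s : ℝ, 0 ≤ s → 0 ≤ ν s)
    (hmono : ∀ s₁ s₂ : ℝ, 0 ≤ s₁ → 0 ≤ s₂ →
      νlo * (s₁ - s₂) ^ 2 ≤ (ν s₁ * s₁ - ν s₂ * s₂) * (s₁ - s₂))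
    (hlip : ∀ s₁ s₂ : ℝ, 0 ≤ s₁ → 0 ≤ s₂ →
      |ν s₁ * s₁ - ν s₂ * s₂| ≤ νhi * |s₁ - s₂|) :
    ∀ a b : EuclideanSpace ℝ (Fin d),
      νlo * ‖a - b‖ ^ 2 ≤ ⟪ν ‖a‖ • a - ν ‖b‖ • b, a - b⟫ := by
  intro a b
  have lower_bound : ∀ s : ℝ, 0 < s → νlo ≤ ν s := by
    intro s hs
    have h := hmono s 0 hs.le le_rfl
    refine le_of_mul_le_mul_right ?_ (pow_pos hs 2)
    linarith
  have expand_norm : ‖a - b‖ ^ 2 = ‖a‖ ^ 2 - 2 * ⟪a, b⟫ + ‖b‖ ^ 2 := norm_sub_sq_real a b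
  have expand_inner : ⟪ν ‖a‖ • a - ν ‖b‖ • b, a - b⟫
      = ν ‖a‖ * ‖a‖ ^ 2 + ν ‖b‖ * ‖b‖ ^ 2 - (ν ‖a‖ + ν ‖b‖) * ⟪a, b⟫ := by
    simp only [inner_sub_left, inner_sub_right, real_inner_smul_left,
      real_inner_self_eq_norm_sq, real_inner_comm a b]
    ring
  have radial := hmono ‖a‖ ‖b‖ (norm_nonneg a) (norm_nonneg b)
  have angular : 0 ≤ (ν ‖a‖ + ν ‖b‖ - 2 * νlo) * (‖a‖ * ‖b‖ - ⟪a, b⟫) := by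
    rcases eq_or_ne a 0 with rfl | ha
    · simp
    rcases eq_or_ne b 0 with rfl | hb
    · simp
    have hνa := lower_bound ‖a‖ (norm_pos_iff.mpr ha)
    have hνb := lower_bound ‖b‖ (norm_pos_iff.mpr hb)
    exact mul_nonneg (by linarith) (sub_nonneg.mpr (real_inner_le_norm a b))
  rw [expand_norm, expand_inner]
  linarith
end

section
/- Let ν̂ : [0,∞) → [0,∞) satisfy the strong monotonicity and Lipschitz conditions with constants 0 < ν_ ≤ ν̄ < ∞, and let d ≥ 1. Then the vector field a ↦ ν̂(|a|)a on ℝ^d is Lipschitz continuous with a constant depending only on ν̄: for all a, b ∈ ℝ^d, |ν̂(|a|)a − ν̂(|b|)b| ≤ 3ν̄ |a − b|. -/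
/-- If `s ↦ ν s * s` is Lipschitz on `[0, ∞)` with constant `L` and `ν` is nonnegative there, then
`a ↦ ν ‖a‖ • a` is Lipschitz with constant `3 * L` on every real normed space. -/
theorem norm_smul_norm_sub_smul_norm_le {E : Type*} [NormedAddCommGroup E] [NormedSpace ℝ E]
    {ν : ℝ → ℝ} {L : ℝ} (hL : 0 ≤ L) (hnn : ∀ s : ℝ, 0 ≤ s → 0 ≤ ν s)
    (hlip : ∀ s₁ s₂ : ℝ, 0 ≤ s₁ → 0 ≤ s₂ → |ν s₁ * s₁ - ν s₂ * s₂| ≤ L * |s₁ - s₂|) (a b : E) :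
    ‖ν ‖a‖ • a - ν ‖b‖ • b‖ ≤ 3 * L * ‖a - b‖ := by
  have hzero : ∀ s : ℝ, 0 ≤ s → ν s * s ≤ L * s := fun s hs ↦ by
    simpa [abs_of_nonneg hs, abs_of_nonneg (hnn s hs)] using hlip s 0 hs le_rfl
  rcases eq_or_ne a 0 with rfl | ha
  · have h := hzero ‖b‖ (norm_nonneg b)
    have hb : 0 ≤ L * ‖b‖ := by positivity
    simp only [smul_zero, zero_sub, norm_neg, norm_smul, Real.norm_eq_abs,
      abs_of_nonneg (hnn ‖b‖ (norm_nonneg b))]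
    linarith
  have hν : ν ‖a‖ ≤ L := le_of_mul_le_mul_right (hzero ‖a‖ (norm_nonneg a)) (norm_pos_iff.2 ha)
  have hν0 : 0 ≤ ν ‖a‖ := hnn ‖a‖ (norm_nonneg a)
  have hab : |‖a‖ - ‖b‖| ≤ ‖a - b‖ := abs_norm_sub_norm_le a b
  have hsecond : |ν ‖a‖ - ν ‖b‖| * ‖b‖ ≤ L * ‖a - b‖ + L * ‖a - b‖ :=
    calc |ν ‖a‖ - ν ‖b‖| * ‖b‖ = |(ν ‖a‖ - ν ‖b‖) * ‖b‖| := by rw [abs_mul, abs_norm]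
      _ = |(ν ‖a‖ * ‖a‖ - ν ‖b‖ * ‖b‖) - ν ‖a‖ * (‖a‖ - ‖b‖)| := by ring_nf
      _ ≤ |ν ‖a‖ * ‖a‖ - ν ‖b‖ * ‖b‖| + |ν ‖a‖ * (‖a‖ - ‖b‖)| := abs_sub _ _
      _ ≤ L * |‖a‖ - ‖b‖| + ν ‖a‖ * |‖a‖ - ‖b‖| := by
        rw [abs_mul, abs_of_nonneg hν0]
        gcongr
        exact hlip _ _ (norm_nonneg a) (norm_nonneg b)
      _ ≤ L * ‖a - b‖ + L * ‖a - b‖ := by gcongr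
  calc ‖ν ‖a‖ • a - ν ‖b‖ • b‖ = ‖ν ‖a‖ • (a - b) + (ν ‖a‖ - ν ‖b‖) • b‖ := by
        congr 1; module
    _ ≤ ‖ν ‖a‖ • (a - b)‖ + ‖(ν ‖a‖ - ν ‖b‖) • b‖ := norm_add_le _ _
    _ = ν ‖a‖ * ‖a - b‖ + |ν ‖a‖ - ν ‖b‖| * ‖b‖ := by
        rw [norm_smul, norm_smul, Real.norm_eq_abs, Real.norm_eq_abs, abs_of_nonneg hν0]
    _ ≤ L * ‖a - b‖ + (L * ‖a - b‖ + L * ‖a - b‖) := by gcongr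
    _ = 3 * L * ‖a - b‖ := by ring

/-- If `s ↦ ν̂(s)s` is strongly monotone with constant `ν_ > 0` and Lipschitz with constant `ν̄`,
then the vector field `a ↦ ν̂(|a|)a` on `ℝ^d` is Lipschitz continuous with constant `3ν̄`:
`|ν̂(|a|)a − ν̂(|b|)b| ≤ 3ν̄ |a − b|` for all `a, b`. -/
theorem stmt_3 (d : ℕ) (hd : 1 ≤ d) (ν : ℝ → ℝ) (νlo νhi : ℝ)
    (hlo : 0 < νlo) (hle : νlo ≤ νhi)
    (hnn : ∀ s : ℝ, 0 ≤ s → 0 ≤ ν s)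
    (hmono : ∀ s₁ s₂ : ℝ, 0 ≤ s₁ → 0 ≤ s₂ →
      νlo * (s₁ - s₂) ^ 2 ≤ (ν s₁ * s₁ - ν s₂ * s₂) * (s₁ - s₂))
    (hlip : ∀ s₁ s₂ : ℝ, 0 ≤ s₁ → 0 ≤ s₂ →
      |ν s₁ * s₁ - ν s₂ * s₂| ≤ νhi * |s₁ - s₂|) :
    ∀ a b : EuclideanSpace ℝ (Fin d),
      ‖ν ‖a‖ • a - ν ‖b‖ • b‖ ≤ 3 * νhi * ‖a - b‖ := by
  exact norm_smul_norm_sub_smul_norm_le (hlo.le.trans hle) hnn hlip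
end

section
/- Let ν̂ : [0,∞) → [0,∞) satisfy the strong monotonicity and Lipschitz conditions with constants 0 < ν_ ≤ ν̄ < ∞, and assume ν̂ is differentiable on (0,∞). Let d ≥ 1, let g ∈ ℝ^d with g ≠ 0, and consider the symmetric matrix A = ν̂(|g|) I + (ν̂'(|g|)/|g|) g ⊗ g. Then A is uniformly elliptic with constant ν_: for every ξ ∈ ℝ^d, ⟨A ξ, ξ⟩ = ν̂(|g|)|ξ|² + (ν̂'(|g|)/|g|) ⟨g, ξ⟩² ≥ ν_ |ξ|². -/
open scoped RealInnerProductSpace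

/-- A function that is strongly monotone on `[0,∞)` with constant `c` has derivative at least `c`
at every point of `[0,∞)` where it is differentiable. -/
theorem le_deriv_of_strongMono {f : ℝ → ℝ} {c f' s : ℝ} (hs : 0 ≤ s)
    (hmono : ∀ s₁ s₂ : ℝ, 0 ≤ s₁ → 0 ≤ s₂ → c * (s₁ - s₂) ^ 2 ≤ (f s₁ - f s₂) * (s₁ - s₂))
    (hf : HasDerivAt f f' s) : c ≤ f' := by
  have hslope : Filter.Tendsto (slope f s) (nhdsWithin s (Set.Ioi s)) (nhds f') :=
    (hasDerivAt_iff_tendsto_slope.mp hf).mono_left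
      (nhdsWithin_mono s fun y hy => ne_of_gt hy)
  refine ge_of_tendsto hslope ?_
  filter_upwards [self_mem_nhdsWithin] with y hy
  have hys : 0 < y - s := sub_pos.mpr hy
  rw [slope_def_field, le_div_iff₀ hys]
  have h := hmono y s (hs.trans (le_of_lt hy)) hs
  refine le_of_mul_le_mul_right ?_ hys
  linarith [h, (by ring : c * (y - s) * (y - s) = c * (y - s) ^ 2)]

/-- Let `ν̂` satisfy the strong monotonicity and Lipschitz conditions with constants
`0 < ν_ ≤ ν̄` and be differentiable on `(0,∞)`. For `g ≠ 0` in `ℝ^d`, the symmetric matrix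
`A = ν̂(|g|) I + (ν̂'(|g|)/|g|) g ⊗ g` (here represented through its action on vectors,
`A ξ = ν̂(|g|) ξ + (ν̂'(|g|)/|g|) ⟨g, ξ⟩ g`) is uniformly elliptic with constant `ν_`:
for every `ξ`, `⟨A ξ, ξ⟩ = ν̂(|g|)|ξ|² + (ν̂'(|g|)/|g|) ⟨g, ξ⟩² ≥ ν_ |ξ|²`. -/
theorem stmt_5 (d : ℕ) (hd : 1 ≤ d) (ν : ℝ → ℝ) (νlo νhi : ℝ)
    (hlo : 0 < νlo) (hle : νlo ≤ νhi)
    (hnn : ∀ s : ℝ, 0 ≤ s → 0 ≤ ν s)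
    (hmono : ∀ s₁ s₂ : ℝ, 0 ≤ s₁ → 0 ≤ s₂ →
      νlo * (s₁ - s₂) ^ 2 ≤ (ν s₁ * s₁ - ν s₂ * s₂) * (s₁ - s₂))
    (hlip : ∀ s₁ s₂ : ℝ, 0 ≤ s₁ → 0 ≤ s₂ →
      |ν s₁ * s₁ - ν s₂ * s₂| ≤ νhi * |s₁ - s₂|)
    (hdiff : ∀ s ∈ Set.Ioi (0 : ℝ), DifferentiableAt ℝ ν s)
    (g : EuclideanSpace ℝ (Fin d)) (hg : g ≠ 0)
    (A : EuclideanSpace ℝ (Fin d) → EuclideanSpace ℝ (Fin d))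
    (hA : ∀ ξ : EuclideanSpace ℝ (Fin d),
      A ξ = ν ‖g‖ • ξ + ((deriv ν ‖g‖ / ‖g‖) * ⟪g, ξ⟫) • g) :
    ∀ ξ : EuclideanSpace ℝ (Fin d),
      ⟪A ξ, ξ⟫ = ν ‖g‖ * ‖ξ‖ ^ 2 + (deriv ν ‖g‖ / ‖g‖) * ⟪g, ξ⟫ ^ 2 ∧
      νlo * ‖ξ‖ ^ 2 ≤ ⟪A ξ, ξ⟫ := by
  intro ξ
  have hs : 0 < ‖g‖ := norm_pos_iff.mpr hg
  have hform :
      ⟪A ξ, ξ⟫ = ν ‖g‖ * ‖ξ‖ ^ 2 + (deriv ν ‖g‖ / ‖g‖) * ⟪g, ξ⟫ ^ 2 := by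
    rw [hA, inner_add_left, real_inner_smul_left, real_inner_smul_left,
      real_inner_self_eq_norm_sq]
    ring
  refine ⟨hform, ?_⟩
  rw [hform]
  have hν : νlo ≤ ν ‖g‖ := by
    have h := hmono ‖g‖ 0 hs.le le_rfl
    simp only [mul_zero, sub_zero] at h
    refine le_of_mul_le_mul_right ?_ (pow_pos hs 2)
    linarith [h, (by ring : ν ‖g‖ * ‖g‖ * ‖g‖ = ν ‖g‖ * ‖g‖ ^ 2)]
  have hderiv : νlo ≤ deriv ν ‖g‖ * ‖g‖ + ν ‖g‖ * 1 :=
    le_deriv_of_strongMono (f := fun s => ν s * s) hs.le hmono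
      ((hdiff ‖g‖ hs).hasDerivAt.mul (hasDerivAt_id' ‖g‖))
  have hcs : ⟪g, ξ⟫ ^ 2 ≤ ‖g‖ ^ 2 * ‖ξ‖ ^ 2 := by
    rw [← mul_pow]
    exact sq_le_sq' (abs_le.mp (abs_real_inner_le_norm g ξ)).1 (real_inner_le_norm g ξ)
  have hsplit : ‖g‖ ^ 2 * (ν ‖g‖ * ‖ξ‖ ^ 2 + (deriv ν ‖g‖ / ‖g‖) * ⟪g, ξ⟫ ^ 2
        - νlo * ‖ξ‖ ^ 2)
      = (ν ‖g‖ - νlo) * (‖g‖ ^ 2 * ‖ξ‖ ^ 2 - ⟪g, ξ⟫ ^ 2)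
        + (deriv ν ‖g‖ * ‖g‖ + ν ‖g‖ * 1 - νlo) * ⟪g, ξ⟫ ^ 2 := by
    field_simp
    ring
  refine sub_nonneg.mp (nonneg_of_mul_nonneg_right ?_ (pow_pos hs 2))
  rw [hsplit]
  exact add_nonneg (mul_nonneg (sub_nonneg.mpr hν) (sub_nonneg.mpr hcs))
    (mul_nonneg (sub_nonneg.mpr hderiv) (sq_nonneg _))
end

section
/- Let T > 0 and let φ : [0,T] × ℝ^d → ℝ^d be a smooth map such that for each t ∈ [0,T] the map φ_t := φ(t,·) is a diffeomorphism of ℝ^d onto itself. Let Ω ⊂ ℝ^d be a bounded Lipschitz open set and let f ∈ C^∞([0,T] × ℝ^d). For a vector field θ, set Ω_θ := (Id + θ)(Ω) and J(Ω_θ) := ∫₀^T ∫_{φ_t(Ω_θ)} f(t,x) dx dt. Then the map θ ↦ J(Ω_θ), defined on the Banach space of bounded continuously differentiable vector fields ℝ^d → ℝ^d with bounded derivative (C¹ supremum norm) restricted to the unit ball, is Fréchet differentiable at θ = 0, and its derivative is given by the volume formula J'(Ω)(θ) = ∫₀^T ∫_{φ_t(Ω)} [ tr( [∇²φ_t(φ_t^{-1}(x))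 θ(φ_t^{-1}(x))] [∇(φ_t^{-1})(x)] ) f(t,x) + (div θ)(φ_t^{-1}(x)) f(t,x) + ⟨ [∇φ_t(φ_t^{-1}(x))]^T ∇f(t,x), θ(φ_t^{-1}(x)) ⟩ ] dx dt, where ∇f denotes the spatial gradient of f. -/
open MeasureTheory
open scoped RealInnerProductSpace

/-- The shape functional `θ ↦ J(Ω_θ) = ∫₀ᵀ ∫_{φ_t((Id+θ)(Ω))} f(t,x) dx dt`. -/
noncomputable def stmt16J (d : ℕ) (T : ℝ)
    (φ : ℝ → EuclideanSpace ℝ (Fin d) → EuclideanSpace ℝ (Fin d))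
    (Ω : Set (EuclideanSpace ℝ (Fin d))) (f : ℝ → EuclideanSpace ℝ (Fin d) → ℝ)
    (θ : EuclideanSpace ℝ (Fin d) → EuclideanSpace ℝ (Fin d)) : ℝ :=
  ∫ t in (0 : ℝ)..T, ∫ x in φ t '' ((fun z => z + θ z) '' Ω), f t x

/-- The volume form of the shape derivative of `stmt16J` at `θ = 0`:
`J'(Ω)(θ) = ∫₀ᵀ ∫_{φ_t(Ω)} [ tr([∇²φ_t(φ_t⁻¹x) θ(φ_t⁻¹x)][∇(φ_t⁻¹)(x)]) f
  + (div θ)(φ_t⁻¹x) f + ⟨[∇φ_t(φ_t⁻¹x)]ᵀ ∇f(t,x), θ(φ_t⁻¹x)⟩ ] dx dt`. -/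
noncomputable def stmt16J' (d : ℕ) (T : ℝ)
    (φ ψ : ℝ → EuclideanSpace ℝ (Fin d) → EuclideanSpace ℝ (Fin d))
    (Ω : Set (EuclideanSpace ℝ (Fin d))) (f : ℝ → EuclideanSpace ℝ (Fin d) → ℝ)
    (θ : EuclideanSpace ℝ (Fin d) → EuclideanSpace ℝ (Fin d)) : ℝ :=
  ∫ t in (0 : ℝ)..T, ∫ x in φ t '' Ω,
    (LinearMap.trace ℝ (EuclideanSpace ℝ (Fin d))
        ((((fderiv ℝ (fun z => fderiv ℝ (φ t) z) (ψ t x)) (θ (ψ t x))).comp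
          (fderiv ℝ (ψ t) x)).toLinearMap) * f t x
      + LinearMap.trace ℝ (EuclideanSpace ℝ (Fin d))
          ((fderiv ℝ θ (ψ t x)).toLinearMap) * f t x
      + ⟪ContinuousLinearMap.adjoint (fderiv ℝ (φ t) (ψ t x))
            (gradient (fun y => f t y) x), θ (ψ t x)⟫)


section Determinant

variable {E : Type*} [NormedAddCommGroup E] [NormedSpace ℝ E] [FiniteDimensional ℝ E]

/-- The trace of a continuous endomorphism, as a continuous linear form. -/
noncomputable def traceCLM (E : Type*) [NormedAddCommGroup E] [NormedSpace ℝ E]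
    [FiniteDimensional ℝ E] : (E →L[ℝ] E) →L[ℝ] ℝ :=
  LinearMap.toContinuousLinearMap ((LinearMap.trace ℝ E).comp (ContinuousLinearMap.coeLM ℝ))

lemma traceCLM_apply (A : E →L[ℝ] E) :
    traceCLM E A = LinearMap.trace ℝ E A.toLinearMap := rfl

lemma contDiff_clm_det {n : WithTop ℕ∞} : ContDiff ℝ n (fun A : E →L[ℝ] E => A.det) := by
  classical
  let b := Module.finBasis ℝ E
  have h : (fun A : E →L[ℝ] E => A.det) = fun A => ∑ σ : Equiv.Perm (Fin (Module.finrank ℝ E)),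
      ((Equiv.Perm.sign σ : ℤ) : ℝ) * ∏ i, b.repr (A (b i)) (σ i) := by
    funext A
    rw [ContinuousLinearMap.det, ← LinearMap.det_toMatrix b, Matrix.det_apply']
    simp [LinearMap.toMatrix_apply]
  rw [h]
  refine ContDiff.sum fun σ _ => contDiff_const.mul (contDiff_prod fun i _ => ?_)
  exact (LinearMap.toContinuousLinearMap (b.coord (σ i))).contDiff.comp
    (contDiff_id.clm_apply contDiff_const)

omit [FiniteDimensional ℝ E] in
lemma clm_det_comp (A B : E →L[ℝ] E) : (A.comp B).det = A.det * B.det := by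
  simp [ContinuousLinearMap.det, LinearMap.det_comp]

omit [FiniteDimensional ℝ E] in
lemma clm_det_id : (ContinuousLinearMap.id ℝ E).det = 1 := by
  simp [ContinuousLinearMap.det]

lemma hasFDerivAt_clm_det_id :
    HasFDerivAt (fun A : E →L[ℝ] E => A.det) (traceCLM E) (ContinuousLinearMap.id ℝ E) := by
  have hd : DifferentiableAt ℝ (fun A : E →L[ℝ] E => A.det) (ContinuousLinearMap.id ℝ E) :=
    (contDiff_clm_det (n := 1)).differentiable one_ne_zero _
  convert! hd.hasFDerivAt using 1
  ext A
  have h1 : HasDerivAt (fun s : ℝ => ContinuousLinearMap.id ℝ E + s • A) A 0 := by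
    simpa using ((hasDerivAt_id (0 : ℝ)).smul_const A).const_add (ContinuousLinearMap.id ℝ E)
  have h2 := HasFDerivAt.comp_hasDerivAt_of_eq (0 : ℝ) hd.hasFDerivAt h1 (by simp)
  let b := Module.finBasis ℝ E
  let M := LinearMap.toMatrix b b A.toLinearMap
  have h3 : HasDerivAt ((fun A : E →L[ℝ] E => A.det) ∘
      fun s : ℝ => ContinuousLinearMap.id ℝ E + s • A) (traceCLM E A) 0 := by
    have : ((fun A : E →L[ℝ] E => A.det) ∘ fun s : ℝ => ContinuousLinearMap.id ℝ E + s • A) =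
        fun s => 1 + M.trace * s +
          (Matrix.det (1 + (Polynomial.X : Polynomial ℝ) •
            M.map Polynomial.C)).divX.divX.eval s * s ^ 2 := by
      funext s
      rw [← Matrix.det_one_add_smul, Function.comp_apply, ContinuousLinearMap.det,
        ← LinearMap.det_toMatrix b]
      congr 1
      simp [M]
    rw [this, traceCLM_apply, LinearMap.trace_eq_matrix_trace ℝ b]
    have h4 := ((((hasDerivAt_id (0 : ℝ)).const_mul M.trace).const_add 1).add
      ((((Matrix.det (1 + (Polynomial.X : Polynomial ℝ) •
            M.map Polynomial.C)).divX.divX).hasDerivAt 0).mul ((hasDerivAt_id (0 : ℝ)).pow 2)))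
    convert! h4 using 1
    simp [M]
  exact h3.unique h2

/-- Jacobi's formula at an invertible endomorphism `L` with right inverse `R`. -/
lemma hasFDerivAt_clm_det {L R : E →L[ℝ] E} (hR : L.comp R = ContinuousLinearMap.id ℝ E) :
    HasFDerivAt (fun A : E →L[ℝ] E => A.det)
      (L.det • (traceCLM E).comp ((ContinuousLinearMap.compL ℝ E E E).flip R)) L := by
  have h : (fun A : E →L[ℝ] E => A.det) = fun A => L.det * (A.comp R).det := by
    funext A
    have := congrArg ContinuousLinearMap.det hR
    rw [clm_det_comp, clm_det_id] at this
    rw [clm_det_comp]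
    linear_combination -A.det * this
  rw [h]
  have h1 : HasFDerivAt (fun A : E →L[ℝ] E => A.comp R)
      ((ContinuousLinearMap.compL ℝ E E E).flip R) L :=
    ((ContinuousLinearMap.compL ℝ E E E).flip R).hasFDerivAt
  exact (HasFDerivAt.comp L (hR ▸ hasFDerivAt_clm_det_id) h1).const_mul L.det

lemma exists_det_id_add_expansion {η : ℝ} (hη : 0 < η) :
    ∃ δ > 0, ∀ A : E →L[ℝ] E, ‖A‖ ≤ δ →
      |(ContinuousLinearMap.id ℝ E + A).det - 1 - LinearMap.trace ℝ E A.toLinearMap| ≤ η * ‖A‖ := by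
  have h := (hasFDerivAt_iff_isLittleO_nhds_zero.1 (hasFDerivAt_clm_det_id (E := E))).def hη
  obtain ⟨δ, hδ, h⟩ := Metric.eventually_nhds_iff.1 h
  refine ⟨δ / 2, half_pos hδ, fun A hA => ?_⟩
  have := h (y := A) (by rw [dist_zero_right]; linarith)
  simpa only [clm_det_id, traceCLM_apply, Real.norm_eq_abs] using this

end Determinant

section Slices

variable {E F : Type*} [NormedAddCommGroup E] [NormedSpace ℝ E]
  [NormedAddCommGroup F] [NormedSpace ℝ F]

lemma ContDiffOn.hasFDerivAt_slice {T : ℝ} {g : ℝ → E → F}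
    (hg : ContDiffOn ℝ (⊤ : ℕ∞) (fun q : ℝ × E => g q.1 q.2) (Set.Icc 0 T ×ˢ Set.univ))
    {t : ℝ} (ht : t ∈ Set.Icc 0 T) (x : E) :
    HasFDerivAt (g t) ((fderivWithin ℝ (fun q : ℝ × E => g q.1 q.2) (Set.Icc 0 T ×ˢ Set.univ)
      (t, x)).comp (ContinuousLinearMap.inr ℝ ℝ E)) x := by
  have h1 := (hg.differentiableOn (by simp) (t, x) ⟨ht, trivial⟩).hasFDerivWithinAt
  have h2 : HasFDerivWithinAt (fun y : E => (t, y)) (ContinuousLinearMap.inr ℝ ℝ E) Set.univ x :=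
    (hasFDerivAt_prodMk_right t x).hasFDerivWithinAt
  exact (h1.comp x h2 fun y _ => ⟨ht, trivial⟩).hasFDerivAt_of_univ

lemma ContDiffOn.fderiv_slice {T : ℝ} (hT : 0 < T) {g : ℝ → E → F}
    (hg : ContDiffOn ℝ (⊤ : ℕ∞) (fun q : ℝ × E => g q.1 q.2) (Set.Icc 0 T ×ˢ Set.univ)) :
    ContDiffOn ℝ (⊤ : ℕ∞) (fun q : ℝ × E => fderiv ℝ (g q.1) q.2)
      (Set.Icc 0 T ×ˢ Set.univ) := by
  have hu : UniqueDiffOn ℝ (Set.Icc 0 T ×ˢ (Set.univ : Set E)) :=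
    (uniqueDiffOn_Icc hT).prod uniqueDiffOn_univ
  refine ((hg.fderivWithin hu (m := (⊤ : ℕ∞)) (by simp)).clm_comp
    (contDiffOn_const (c := ContinuousLinearMap.inr ℝ ℝ E))).congr ?_
  rintro ⟨t, x⟩ ⟨ht, -⟩
  exact (hg.hasFDerivAt_slice ht x).fderiv

end Slices

section Expansion

variable {E : Type*} [NormedAddCommGroup E] [NormedSpace ℝ E] [FiniteDimensional ℝ E]

omit [FiniteDimensional ℝ E] in
lemma exists_abs_det_id_add_sub_one_le {η : ℝ} (hη : 0 < η) :
    ∃ δ > 0, ∀ A : E →L[ℝ] E, ‖A‖ ≤ δ →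
      |(ContinuousLinearMap.id ℝ E + A).det - 1| ≤ η := by
  have hc : Continuous fun A : E →L[ℝ] E => (ContinuousLinearMap.id ℝ E + A).det :=
    ContinuousLinearMap.continuous_det.comp (continuous_const.add continuous_id)
  obtain ⟨δ, hδ, h⟩ := Metric.continuous_iff.1 hc 0 η hη
  refine ⟨δ / 2, half_pos hδ, fun A hA => ?_⟩
  have := h A (by rw [dist_zero_right]; linarith)
  rw [add_zero, clm_det_id, Real.dist_eq] at this
  exact this.le

/-- First order expansion of `G t (z + v) * det (id + A)`, uniform over `t` in a compact interval
and `z` in a bounded set. -/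
lemma exists_uniform_expansion {T : ℝ} (hT : 0 < T) {G : ℝ → E → ℝ}
    (hG : ContDiffOn ℝ (⊤ : ℕ∞) (fun q : ℝ × E => G q.1 q.2) (Set.Icc 0 T ×ˢ Set.univ))
    {Ω : Set E} (hΩ : Bornology.IsBounded Ω) {ε : ℝ} (hε : 0 < ε) :
    ∃ δ > 0, ∀ t ∈ Set.Icc 0 T, ∀ z ∈ Ω, ∀ (v : E) (A : E →L[ℝ] E) (m : ℝ),
      ‖v‖ ≤ δ → ‖A‖ ≤ δ → ‖v‖ ≤ m → ‖A‖ ≤ m →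
      |G t (z + v) * (ContinuousLinearMap.id ℝ E + A).det - G t z
        - (fderiv ℝ (G t) z v + G t z * LinearMap.trace ℝ E A.toLinearMap)| ≤ ε * m := by
  have : ProperSpace E := FiniteDimensional.proper ℝ E
  obtain ⟨R, hR⟩ := hΩ.subset_closedBall 0
  have hK : IsCompact (Set.Icc 0 T ×ˢ Metric.closedBall (0 : E) (R + 1)) :=
    isCompact_Icc.prod (isCompact_closedBall _ _)
  have hsub : Set.Icc 0 T ×ˢ Metric.closedBall (0 : E) (R + 1) ⊆ Set.Icc 0 T ×ˢ Set.univ :=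
    Set.prod_mono_right (Set.subset_univ _)
  have hGc := hG.continuousOn.mono hsub
  have hG'c := (hG.fderiv_slice hT).continuousOn.mono hsub
  obtain ⟨M₀, hM₀⟩ := hK.exists_bound_of_continuousOn hGc
  obtain ⟨M₁, hM₁⟩ := hK.exists_bound_of_continuousOn hG'c
  set M := max 0 (max M₀ M₁) with hM
  have hM0 : 0 ≤ M := le_max_left _ _
  set η := min 1 (ε / (2 + 2 * M)) with hη
  have hη0 : 0 < η := lt_min one_pos (by positivity)
  have hη1 : η ≤ 1 := min_le_left _ _
  have hηε : η * (2 + 2 * M) ≤ ε := by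
    rw [← le_div_iff₀ (by positivity)]
    exact min_le_right _ _
  obtain ⟨δ₁, hδ₁, hu⟩ := Metric.uniformContinuousOn_iff_le.1
    (hK.uniformContinuousOn_of_continuous hG'c) η hη0
  obtain ⟨δ₂, hδ₂, hdet⟩ := exists_det_id_add_expansion (E := E) hη0
  obtain ⟨δ₃, hδ₃, hdet'⟩ := exists_abs_det_id_add_sub_one_le (E := E) hη0
  refine ⟨min (min 1 δ₁) (min δ₂ δ₃), lt_min (lt_min one_pos hδ₁) (lt_min hδ₂ hδ₃), ?_⟩
  intro t ht z hz v A m hv hA hvm hAm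
  simp only [le_min_iff] at hv hA
  have hball : ∀ y ∈ Metric.closedBall z ‖v‖, y ∈ Metric.closedBall (0 : E) (R + 1) := by
    intro y hy
    have hz' := hR hz
    simp only [Metric.mem_closedBall] at hy hz' ⊢
    linarith [dist_triangle y z 0, hv.1.1]
  have hzz : z ∈ Metric.closedBall z ‖v‖ := Metric.mem_closedBall_self (norm_nonneg v)
  have hzK : (t, z) ∈ Set.Icc 0 T ×ˢ Metric.closedBall (0 : E) (R + 1) := ⟨ht, hball z hzz⟩
  have h1 : |G t (z + v) - G t z - fderiv ℝ (G t) z v| ≤ η * m := by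
    have := (convex_closedBall z ‖v‖).norm_image_sub_le_of_norm_fderiv_le' (𝕜 := ℝ) (f := G t)
      (φ := fderiv ℝ (G t) z) (C := η) (x := z) (y := z + v)
      (fun y _ => (hG.hasFDerivAt_slice ht y).differentiableAt)
      (fun y hy => by
        rw [← dist_eq_norm]
        refine hu (t, y) ⟨ht, hball y hy⟩ (t, z) hzK ?_
        rw [Prod.dist_eq, dist_self, max_eq_right dist_nonneg]
        exact (Metric.mem_closedBall.1 hy).trans hv.1.2)
      hzz (by simp)
    rw [add_sub_cancel_left, Real.norm_eq_abs] at this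
    exact this.trans (by gcongr)
  have h2 := (hdet A hA.2.1).trans (mul_le_mul_of_nonneg_left hAm hη0.le)
  have h3 := hdet' A hA.2.2
  have h4 : |G t z| ≤ M :=
    (hM₀ _ hzK).trans ((le_max_left _ _).trans (le_max_right _ _))
  have h5 : |fderiv ℝ (G t) z v| ≤ M * m := by
    refine ((fderiv ℝ (G t) z).le_opNorm v).trans ?_
    have := (hM₁ _ hzK).trans ((le_max_right M₀ M₁).trans (le_max_right 0 _))
    gcongr
  have hm : 0 ≤ m := (norm_nonneg v).trans hvm
  set D := (ContinuousLinearMap.id ℝ E + A).det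
  set τ := LinearMap.trace ℝ E A.toLinearMap
  have h6 : |D| ≤ 2 := by
    have := abs_add_le (D - 1) 1
    rw [sub_add_cancel, abs_one] at this
    linarith
  have hsplit : G t (z + v) * D - G t z - (fderiv ℝ (G t) z v + G t z * τ) =
      (G t (z + v) - G t z - fderiv ℝ (G t) z v) * D + G t z * (D - 1 - τ)
        + fderiv ℝ (G t) z v * (D - 1) := by ring
  rw [hsplit]
  calc _ ≤ |(G t (z + v) - G t z - fderiv ℝ (G t) z v) * D| + |G t z * (D - 1 - τ)|
        + |fderiv ℝ (G t) z v * (D - 1)| := abs_add_three _ _ _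
    _ ≤ η * m * 2 + M * (η * m) + M * m * η := by
        rw [abs_mul, abs_mul, abs_mul]
        gcongr
    _ = η * (2 + 2 * M) * m := by ring
    _ ≤ ε * m := by gcongr

variable [MeasurableSpace E] [BorelSpace E] {μ : Measure E} [IsFiniteMeasureOnCompacts μ]

lemma ContinuousOn.integrableOn_slice {T : ℝ} {H : ℝ × E → ℝ}
    (hH : ContinuousOn H (Set.Icc 0 T ×ˢ Set.univ))
    {Ω : Set E} (hΩ : Bornology.IsBounded Ω) {t : ℝ} (ht : t ∈ Set.Icc 0 T) :
    IntegrableOn (fun z => H (t, z)) Ω μ := by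
  have : ProperSpace E := FiniteDimensional.proper ℝ E
  have hc : Continuous fun z => H (t, z) := by
    rw [← continuousOn_univ]
    exact hH.comp (f := fun y : E => (t, y)) (by fun_prop) fun y _ => ⟨ht, trivial⟩
  exact (hc.continuousOn.integrableOn_compact hΩ.isCompact_closure).mono_set subset_closure

lemma ContinuousOn.intervalIntegrable_setIntegral {T : ℝ} (hT : 0 < T) {H : ℝ → E → ℝ}
    (hH : ContinuousOn (fun q : ℝ × E => H q.1 q.2) (Set.Icc 0 T ×ˢ Set.univ))
    {Ω : Set E} (hΩ : Bornology.IsBounded Ω) :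
    IntervalIntegrable (fun t => ∫ z in Ω, H t z ∂μ) volume 0 T := by
  have : ProperSpace E := FiniteDimensional.proper ℝ E
  have hc : Continuous (Function.uncurry fun (t : ℝ) (z : E) => H (Set.projIcc 0 T hT.le t) z) :=
    hH.comp_continuous (f := fun q : ℝ × E => ((Set.projIcc 0 T hT.le q.1 : ℝ), q.2))
      (by fun_prop) fun q => ⟨Subtype.coe_prop _, trivial⟩
  have h1 := continuous_parametric_integral_of_continuous (μ := μ.restrict Ω) hc
    hΩ.isCompact_closure
  rw [Measure.restrict_restrict isClosed_closure.measurableSet,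
    Set.inter_eq_right.2 subset_closure] at h1
  refine (h1.continuousOn.congr fun t ht => ?_).intervalIntegrable
  rw [Set.uIcc_of_le hT.le] at ht
  simp [Set.projIcc_of_mem hT.le ht]

/-- The functional `θ ↦ ∫₀ᵀ ∫_Ω G(t, z + θ z) det (id + Dθ z) dz dt` is Fréchet differentiable
at `0` for the `C¹` supremum norm. -/
lemma exists_integral_expansion {T : ℝ} (hT : 0 < T) {G : ℝ → E → ℝ}
    (hG : ContDiffOn ℝ (⊤ : ℕ∞) (fun q : ℝ × E => G q.1 q.2) (Set.Icc 0 T ×ˢ Set.univ))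
    {Ω : Set E} (hΩ : Bornology.IsBounded Ω) {ε : ℝ} (hε : 0 < ε) :
    ∃ δ > 0, ∀ θ : E → E, ContDiff ℝ 1 θ → (∀ z, ‖θ z‖ ≤ δ) → (∀ z, ‖fderiv ℝ θ z‖ ≤ δ) →
      |(∫ t in (0 : ℝ)..T, ∫ z in Ω,
            G t (z + θ z) * (ContinuousLinearMap.id ℝ E + fderiv ℝ θ z).det ∂μ)
          - (∫ t in (0 : ℝ)..T, ∫ z in Ω, G t z ∂μ)
          - ∫ t in (0 : ℝ)..T, ∫ z in Ω, (fderiv ℝ (G t) z (θ z)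
              + G t z * LinearMap.trace ℝ E (fderiv ℝ θ z).toLinearMap) ∂μ|
        ≤ ε * max (⨆ z, ‖θ z‖) (⨆ z, ‖fderiv ℝ θ z‖) := by
  have : ProperSpace E := FiniteDimensional.proper ℝ E
  set V := μ.real Ω
  have hV : 0 ≤ V := measureReal_nonneg
  have hΩfin : μ Ω < ⊤ := hΩ.measure_lt_top
  obtain ⟨δ, hδ, h⟩ := exists_uniform_expansion hT hG hΩ (ε := ε / (V * T + 1)) (by positivity)
  refine ⟨δ, hδ, fun θ hθ hθ0 hθ1 => ?_⟩
  set m := max (⨆ z, ‖θ z‖) (⨆ z, ‖fderiv ℝ θ z‖)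
  have hm0 : ∀ z, ‖θ z‖ ≤ m := fun z =>
    (le_ciSup ⟨δ, Set.forall_mem_range.2 hθ0⟩ z).trans (le_max_left _ _)
  have hm1 : ∀ z, ‖fderiv ℝ θ z‖ ≤ m := fun z =>
    (le_ciSup (f := fun z => ‖fderiv ℝ θ z‖) ⟨δ, Set.forall_mem_range.2 hθ1⟩ z).trans
      (le_max_right _ _)
  have hm : 0 ≤ m := (norm_nonneg _).trans (hm0 0)
  have hθc : Continuous θ := hθ.continuous
  have hθ'c : Continuous (fderiv ℝ θ) := hθ.continuous_fderiv one_ne_zero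
  have hdc : Continuous fun z => (ContinuousLinearMap.id ℝ E + fderiv ℝ θ z).det :=
    ContinuousLinearMap.continuous_det.comp (continuous_const.add hθ'c)
  have htc : Continuous fun z => LinearMap.trace ℝ E (fderiv ℝ θ z).toLinearMap :=
    (traceCLM E).continuous.comp hθ'c
  have c0 : ContinuousOn (fun q : ℝ × E => G q.1 q.2) (Set.Icc 0 T ×ˢ Set.univ) :=
    hG.continuousOn
  have c1 : ContinuousOn (fun q : ℝ × E => G q.1 (q.2 + θ q.2) *
      (ContinuousLinearMap.id ℝ E + fderiv ℝ θ q.2).det) (Set.Icc 0 T ×ˢ Set.univ) := by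
    refine ContinuousOn.mul ?_ (hdc.comp continuous_snd).continuousOn
    exact c0.comp (f := fun q : ℝ × E => (q.1, q.2 + θ q.2))
      (by fun_prop) fun q hq => ⟨hq.1, trivial⟩
  have c2 : ContinuousOn (fun q : ℝ × E => fderiv ℝ (G q.1) q.2 (θ q.2)
      + G q.1 q.2 * LinearMap.trace ℝ E (fderiv ℝ θ q.2).toLinearMap)
      (Set.Icc 0 T ×ˢ Set.univ) :=
    ((hG.fderiv_slice hT).continuousOn.clm_apply (hθc.comp continuous_snd).continuousOn).add
      (c0.mul (htc.comp continuous_snd).continuousOn)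
  rw [← intervalIntegral.integral_sub
      (c1.intervalIntegrable_setIntegral hT hΩ) (c0.intervalIntegrable_setIntegral hT hΩ),
    ← intervalIntegral.integral_sub
      ((c1.intervalIntegrable_setIntegral hT hΩ).sub
        (c0.intervalIntegrable_setIntegral hT hΩ))
      (c2.intervalIntegrable_setIntegral hT hΩ), ← Real.norm_eq_abs]
  refine (intervalIntegral.norm_integral_le_of_norm_le_const
    (C := ε / (V * T + 1) * m * V) fun t ht => ?_).trans ?_
  · rw [Set.uIoc_of_le hT.le] at ht
    have ht' : t ∈ Set.Icc 0 T := Set.Ioc_subset_Icc_self ht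
    have i0 : IntegrableOn (fun z => G t z) Ω μ := c0.integrableOn_slice hΩ ht'
    have i1 : IntegrableOn (fun z => G t (z + θ z) *
        (ContinuousLinearMap.id ℝ E + fderiv ℝ θ z).det) Ω μ := c1.integrableOn_slice hΩ ht'
    have i2 : IntegrableOn (fun z => fderiv ℝ (G t) z (θ z)
        + G t z * LinearMap.trace ℝ E (fderiv ℝ θ z).toLinearMap) Ω μ :=
      c2.integrableOn_slice hΩ ht'
    have i3 : IntegrableOn (fun z => G t (z + θ z) *
        (ContinuousLinearMap.id ℝ E + fderiv ℝ θ z).det - G t z) Ω μ := i1.sub i0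
    rw [← integral_sub i1 i0, ← integral_sub i3 i2]
    exact norm_setIntegral_le_of_norm_le_const hΩfin fun z hz =>
      h t ht' z hz (θ z) (fderiv ℝ θ z) m (hθ0 z) (hθ1 z) (hm0 z) (hm1 z)
  · rw [sub_zero, abs_of_pos hT]
    calc ε / (V * T + 1) * m * V * T = ε * m * (V * T / (V * T + 1)) := by ring
      _ ≤ ε * m * 1 := by
        gcongr
        exact div_le_one_of_le₀ (by linarith) (by positivity)
      _ = ε * m := mul_one _

end Expansion

section ChangeOfVariables

variable {E : Type*} [NormedAddCommGroup E] [NormedSpace ℝ E] [FiniteDimensional ℝ E]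

/-- The density obtained by pulling `f t` back along `φ t`. -/
noncomputable def pullbackDensity (φ : ℝ → E → E) (f : ℝ → E → ℝ) (t : ℝ) (z : E) : ℝ :=
  f t (φ t z) * |(fderiv ℝ (φ t) z).det|

omit [FiniteDimensional ℝ E] in
lemma fderiv_comp_fderiv_of_leftInverse {g h : E → E} (hgh : ∀ x, h (g x) = x) {x : E}
    (hg : DifferentiableAt ℝ g x) (hh : DifferentiableAt ℝ h (g x)) :
    (fderiv ℝ h (g x)).comp (fderiv ℝ g x) = ContinuousLinearMap.id ℝ E := by
  have h1 := hh.hasFDerivAt.comp x hg.hasFDerivAt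
  have h2 : h ∘ g = id := funext hgh
  rw [h2] at h1
  exact h1.unique (hasFDerivAt_id x)

omit [FiniteDimensional ℝ E] in
lemma injective_id_add {θ : E → E} (hθ : Differentiable ℝ θ) {C : ℝ} (hC : C < 1)
    (hb : ∀ z, ‖fderiv ℝ θ z‖ ≤ C) : Function.Injective fun z => z + θ z := by
  intro z w h
  have h1 : z - w = θ w - θ z := by
    rw [sub_eq_sub_iff_add_eq_add, add_comm (θ w)]
    exact h
  have h2 := convex_univ.norm_image_sub_le_of_norm_fderiv_le (𝕜 := ℝ) (f := θ)
    (fun x _ => hθ x) (fun x _ => hb x) (Set.mem_univ z) (Set.mem_univ w)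
  rw [← h1, norm_sub_rev w z] at h2
  have h3 : ‖z - w‖ = 0 := by nlinarith [norm_nonneg (z - w)]
  exact sub_eq_zero.1 (norm_eq_zero.1 h3)

variable {T : ℝ} (hT : 0 < T) {φ ψ : ℝ → E → E}
    (hφ : ContDiffOn ℝ (⊤ : ℕ∞) (fun q : ℝ × E => φ q.1 q.2) (Set.Icc 0 T ×ˢ Set.univ))
    (hψ : ContDiffOn ℝ (⊤ : ℕ∞) (fun q : ℝ × E => ψ q.1 q.2) (Set.Icc 0 T ×ˢ Set.univ))
    (hli : ∀ t ∈ Set.Icc (0 : ℝ) T, ∀ x, ψ t (φ t x) = x)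
    (hri : ∀ t ∈ Set.Icc (0 : ℝ) T, ∀ x, φ t (ψ t x) = x)
    {f : ℝ → E → ℝ}
    (hf : ContDiffOn ℝ (⊤ : ℕ∞) (fun q : ℝ × E => f q.1 q.2) (Set.Icc 0 T ×ˢ Set.univ))

include hφ hψ hli in
omit [FiniteDimensional ℝ E] in
lemma flow_det_ne_zero {t : ℝ} (ht : t ∈ Set.Icc 0 T) (z : E) :
    (fderiv ℝ (φ t) z).det ≠ 0 := by
  have h := congrArg ContinuousLinearMap.det <|
    fderiv_comp_fderiv_of_leftInverse (hli t ht) (x := z)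
    (hφ.hasFDerivAt_slice ht z).differentiableAt (hψ.hasFDerivAt_slice ht _).differentiableAt
  rw [clm_det_comp, clm_det_id] at h
  exact right_ne_zero_of_mul (h ▸ one_ne_zero)

include hT hφ hψ hli hf in
lemma contDiffOn_pullbackDensity :
    ContDiffOn ℝ (⊤ : ℕ∞) (fun q : ℝ × E => pullbackDensity φ f q.1 q.2)
      (Set.Icc 0 T ×ˢ Set.univ) := by
  refine ContDiffOn.mul ?_ (ContDiffOn.abs ?_ ?_)
  · exact hf.comp (f := fun q : ℝ × E => (q.1, φ q.1 q.2)) (contDiffOn_fst.prodMk hφ)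
      fun q hq => ⟨hq.1, trivial⟩
  · exact contDiff_clm_det.comp_contDiffOn (hφ.fderiv_slice hT)
  · exact fun q hq => flow_det_ne_zero hφ hψ hli hq.1 q.2

include hT hφ hψ hli hri hf in
lemma fderiv_pullbackDensity {t : ℝ} (ht : t ∈ Set.Icc 0 T) (z v : E) :
    fderiv ℝ (pullbackDensity φ f t) z v = |(fderiv ℝ (φ t) z).det| *
      (LinearMap.trace ℝ E (((fderiv ℝ (fun y => fderiv ℝ (φ t) y) z v).comp
          (fderiv ℝ (ψ t) (φ t z))).toLinearMap) * f t (φ t z)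
        + fderiv ℝ (f t) (φ t z) (fderiv ℝ (φ t) z v)) := by
  have hφd : ∀ y, DifferentiableAt ℝ (φ t) y := fun y =>
    (hφ.hasFDerivAt_slice ht y).differentiableAt
  have hψd : ∀ y, DifferentiableAt ℝ (ψ t) y := fun y =>
    (hψ.hasFDerivAt_slice ht y).differentiableAt
  have h1 : HasFDerivAt (fun y => f t (φ t y)) _ z :=
    (hf.hasFDerivAt_slice ht (φ t z)).differentiableAt.hasFDerivAt.comp z (hφd z).hasFDerivAt
  have h2 : HasFDerivAt (fun y => fderiv ℝ (φ t) y) (fderiv ℝ (fun y => fderiv ℝ (φ t) y) z) z :=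
    ((hφ.fderiv_slice hT).hasFDerivAt_slice (g := fun t y => fderiv ℝ (φ t) y)
      ht z).differentiableAt.hasFDerivAt
  have hinv : (fderiv ℝ (φ t) z).comp (fderiv ℝ (ψ t) (φ t z)) = ContinuousLinearMap.id ℝ E := by
    have := fderiv_comp_fderiv_of_leftInverse (hri t ht) (x := φ t z) (hψd _) (hφd _)
    rwa [hli t ht z] at this
  have h0 := flow_det_ne_zero hφ hψ hli ht z
  have h3 := ((hasFDerivAt_clm_det hinv).comp z h2).abs h0
  have h4 : HasFDerivAt (pullbackDensity φ f t) _ z := h1.mul h3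
  rw [h4.fderiv]
  have h5 := sign_mul_self (fderiv ℝ (φ t) z).det
  simp only [Function.comp_apply, add_apply, smul_apply,
    ContinuousLinearMap.comp_apply, smul_eq_mul, ContinuousLinearMap.flip_apply,
    ContinuousLinearMap.compL_apply, traceCLM_apply]
  rw [← h5]
  ring

variable [MeasurableSpace E] [BorelSpace E] {μ : Measure E} [μ.IsAddHaarMeasure]

include hφ hli in
lemma setIntegral_flow_image {t : ℝ} (ht : t ∈ Set.Icc 0 T) {Ω : Set E} (hΩ : MeasurableSet Ω)
    (g : E → ℝ) :
    ∫ x in φ t '' Ω, g x ∂μ = ∫ z in Ω, |(fderiv ℝ (φ t) z).det| * g (φ t z) ∂μ :=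
  integral_image_eq_integral_abs_det_fderiv_smul μ hΩ
    (fun z _ => (hφ.hasFDerivAt_slice ht z).differentiableAt.hasFDerivAt.hasFDerivWithinAt)
    (Function.LeftInverse.injective (hli t ht)).injOn g

include hφ hli in
lemma setIntegral_flow_image_perturbation {t : ℝ} (ht : t ∈ Set.Icc 0 T) {Ω : Set E}
    (hΩ : MeasurableSet Ω) {θ : E → E} (hθ : Differentiable ℝ θ) {C : ℝ} (hC : C < 1)
    (hb : ∀ z, ‖fderiv ℝ θ z‖ ≤ C)
    (hdet : ∀ z, 0 ≤ (ContinuousLinearMap.id ℝ E + fderiv ℝ θ z).det) :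
    ∫ x in φ t '' ((fun z => z + θ z) '' Ω), f t x ∂μ =
      ∫ z in Ω, pullbackDensity φ f t (z + θ z) *
        (ContinuousLinearMap.id ℝ E + fderiv ℝ θ z).det ∂μ := by
  have hd : ∀ z, HasFDerivAt (fun z => z + θ z)
      (ContinuousLinearMap.id ℝ E + fderiv ℝ θ z) z := fun z =>
    (hasFDerivAt_id z).add (hθ z).hasFDerivAt
  have hinj := injective_id_add hθ hC hb
  rw [← Set.image_comp, integral_image_eq_integral_abs_det_fderiv_smul μ hΩ
    (fun z _ => ((hφ.hasFDerivAt_slice ht (z + θ z)).differentiableAt.hasFDerivAt.comp z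
      (hd z)).hasFDerivWithinAt)
    ((Function.LeftInverse.injective (hli t ht)).comp hinj).injOn]
  refine setIntegral_congr_fun hΩ fun z _ => ?_
  simp only [clm_det_comp, abs_mul, abs_of_nonneg (hdet z), smul_eq_mul, Function.comp_apply,
    pullbackDensity]
  ring

end ChangeOfVariables

/-- **Shape derivative of the academic functional.** Let `φ : [0,T] × ℝ^d → ℝ^d` be smooth with
each `φ_t` a diffeomorphism of `ℝ^d` (inverse `ψ_t`), let `Ω` be a bounded (Lipschitz) open set
and `f ∈ C^∞([0,T] × ℝ^d)`. Then `θ ↦ J(Ω_θ)`, defined on the unit ball of the space of bounded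
`C¹` vector fields with bounded derivative (`C¹` supremum norm), is Fréchet differentiable at
`θ = 0`, with derivative given by the volume formula `stmt16J'`. -/
theorem stmt_16 (d : ℕ) (T : ℝ) (hT : 0 < T)
    (φ ψ : ℝ → EuclideanSpace ℝ (Fin d) → EuclideanSpace ℝ (Fin d))
    (hφ : ContDiffOn ℝ (⊤ : ℕ∞) (fun q : ℝ × EuclideanSpace ℝ (Fin d) => φ q.1 q.2)
      (Set.Icc 0 T ×ˢ Set.univ))
    (hψ : ContDiffOn ℝ (⊤ : ℕ∞) (fun q : ℝ × EuclideanSpace ℝ (Fin d) => ψ q.1 q.2)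
      (Set.Icc 0 T ×ˢ Set.univ))
    (hli : ∀ t ∈ Set.Icc (0 : ℝ) T, ∀ x, ψ t (φ t x) = x)
    (hri : ∀ t ∈ Set.Icc (0 : ℝ) T, ∀ x, φ t (ψ t x) = x)
    (Ω : Set (EuclideanSpace ℝ (Fin d))) (hΩo : IsOpen Ω) (hΩb : Bornology.IsBounded Ω)
    (f : ℝ → EuclideanSpace ℝ (Fin d) → ℝ)
    (hf : ContDiffOn ℝ (⊤ : ℕ∞) (fun q : ℝ × EuclideanSpace ℝ (Fin d) => f q.1 q.2)
      (Set.Icc 0 T ×ˢ Set.univ)) :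
    ∀ ε > 0, ∃ δ > 0, δ ≤ 1 ∧
      ∀ θ : EuclideanSpace ℝ (Fin d) → EuclideanSpace ℝ (Fin d),
        ContDiff ℝ 1 θ → (∀ z, ‖θ z‖ ≤ δ) → (∀ z, ‖fderiv ℝ θ z‖ ≤ δ) →
        |stmt16J d T φ Ω f θ - stmt16J d T φ Ω f (fun _ => 0)
            - stmt16J' d T φ ψ Ω f θ|
          ≤ ε * max (⨆ z, ‖θ z‖) (⨆ z, ‖fderiv ℝ θ z‖) := by
  intro ε hε
  obtain ⟨δ, hδ, h⟩ := exists_integral_expansion (μ := volume) hT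
    (contDiffOn_pullbackDensity hT hφ hψ hli hf) hΩb hε
  obtain ⟨δ', hδ', hdet⟩ := exists_abs_det_id_add_sub_one_le
    (E := EuclideanSpace ℝ (Fin d)) one_pos
  have hΩm := hΩo.measurableSet
  refine ⟨min (1 / 2) (min δ δ'), lt_min one_half_pos (lt_min hδ hδ'),
    (min_le_left _ _).trans (by norm_num), fun θ hθ hθ0 hθ1 => ?_⟩
  simp only [le_min_iff] at hθ0 hθ1
  have key := h θ hθ (fun z => (hθ0 z).2.1) (fun z => (hθ1 z).2.1)
  have hθd : Differentiable ℝ θ := hθ.differentiable one_ne_zero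
  have hpos : ∀ z, 0 ≤
      (ContinuousLinearMap.id ℝ (EuclideanSpace ℝ (Fin d)) + fderiv ℝ θ z).det := fun z => by
    have := (abs_le.1 (hdet _ (hθ1 z).2.2)).1
    linarith
  have e1 : stmt16J d T φ Ω f θ = ∫ t in (0 : ℝ)..T, ∫ z in Ω,
      pullbackDensity φ f t (z + θ z) *
        (ContinuousLinearMap.id ℝ (EuclideanSpace ℝ (Fin d)) + fderiv ℝ θ z).det := by
    refine intervalIntegral.integral_congr fun t ht => ?_
    rw [Set.uIcc_of_le hT.le] at ht
    exact setIntegral_flow_image_perturbation hφ hli ht hΩm hθd one_half_lt_one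
      (fun z => (hθ1 z).1) hpos
  have e0 : stmt16J d T φ Ω f (fun _ => 0) = ∫ t in (0 : ℝ)..T, ∫ z in Ω,
      pullbackDensity φ f t z := by
    refine intervalIntegral.integral_congr fun t ht => ?_
    rw [Set.uIcc_of_le hT.le] at ht
    simp only [add_zero, Set.image_id', pullbackDensity]
    rw [setIntegral_flow_image hφ hli ht hΩm]
    simp only [mul_comm]
  have e2 : stmt16J' d T φ ψ Ω f θ = ∫ t in (0 : ℝ)..T, ∫ z in Ω,
      (fderiv ℝ (pullbackDensity φ f t) z (θ z) + pullbackDensity φ f t z *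
        LinearMap.trace ℝ (EuclideanSpace ℝ (Fin d)) (fderiv ℝ θ z).toLinearMap) := by
    refine intervalIntegral.integral_congr fun t ht => ?_
    rw [Set.uIcc_of_le hT.le] at ht
    simp only
    rw [setIntegral_flow_image hφ hli ht hΩm]
    refine setIntegral_congr_fun hΩm fun z _ => ?_
    simp only [hli t ht z, ContinuousLinearMap.adjoint_inner_left, inner_gradient_left,
      fderiv_pullbackDensity hT hφ hψ hli hri hf ht, pullbackDensity]
    ring
  rw [e1, e0, e2]
  exact key
end
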